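/- The language K' over A₃ is recognized by a polynomial-size depth-3 OR-output circuit family. -/

import Mathlib

/-- The three-letter alphabet, with letters `la = a`, `lb = b`, `lc = c` (the neutral letter). -/
abbrev A₃ : Type := Fin 3
def la : A₃ := 0
def lb : A₃ := 1
def lc : A₃ := 2

open RegularExpression in
/-- The regular expression `(a·c*·b + c)*`. -/
def Kexp : RegularExpression A₃ :=
  (char la * (char lc).star * char lb + char lc).star

/-- The language `K = (a·c*·b + c)*`. -/
def Klang : Language A₃ := Kexp.matches'

/-- A literal: a predicate checking that some fixed position carries some fixed letter. -/
def IsLiteral {n : ℕ} {A : Type*} (ℓ : (Fin n → A) → Prop) : Prop :=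
  ∃ (p : Fin n) (x : A), ∀ w, ℓ w ↔ w p = x

/-- A depth-3 OR∘AND∘OR circuit of size `s` over literals. -/
def Depth3Circuit {n : ℕ} {A : Type*} (s : ℕ) (C : (Fin n → A) → Prop) : Prop :=
  ∃ s₁ : ℕ, s₁ ≤ s ∧ ∃ t : Fin s₁ → ℕ, (∀ i, t i ≤ s) ∧
    ∃ r : (i : Fin s₁) → Fin (t i) → ℕ, (∀ i j, r i j ≤ s) ∧
      ∃ ℓ : (i : Fin s₁) → (j : Fin (t i)) → Fin (r i j) → ((Fin n → A) → Prop),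
        (∀ i j l, IsLiteral (ℓ i j l)) ∧ ∀ w, C w ↔ ∃ i, ∀ j, ∃ l, ℓ i j l w

/-- A language is recognized by a polynomial-size depth-3 OR-output circuit family. -/
def RecDepth3 {A : Type*} (L : Language A) : Prop :=
  ∃ c d : ℕ, ∀ n : ℕ, ∃ C : (Fin n → A) → Prop,
    Depth3Circuit (c * (n + 1) ^ d) C ∧ ∀ w : Fin n → A, C w ↔ List.ofFn w ∈ L

open RegularExpression in
/-- The regular expression for `K' = K·(b·c*·b)·(a + b + c)*`. -/
def K'exp : RegularExpression A₃ :=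
  Kexp * (char lb * (char lc).star * char lb) * (char la + char lb + char lc).star

/-- The language `K'`. -/
def K'lang : Language A₃ := K'exp.matches'

/-- An OR∘AND∘OR formula indexed by finite types, whose bottom clauses are given by a predicate on
pairs (position, letter), is a depth-3 circuit. -/
theorem Depth3Circuit.of_fintype {n s : ℕ} {A I J : Type*} [Fintype A] [Fintype I] [Fintype J]
    (P : I → J → Fin n → A → Prop) (hI : Fintype.card I ≤ s) (hJ : Fintype.card J ≤ s)
    (hA : n * Fintype.card A ≤ s) :
    Depth3Circuit s (fun w : Fin n → A => ∃ i, ∀ j, ∃ p, P i j p (w p)) := by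
  classical
  let eI := Fintype.equivFin I
  let eJ := Fintype.equivFin J
  let cl (i : Fin (Fintype.card I)) (j : Fin (Fintype.card J)) : Type _ :=
    {z : Fin n × A // P (eI.symm i) (eJ.symm j) z.1 z.2}
  refine ⟨Fintype.card I, hI, fun _ => Fintype.card J, fun _ => hJ,
    fun i j => Fintype.card (cl i j), fun i j => ?_,
    fun i j l w => w ((Fintype.equivFin (cl i j)).symm l).1.1 =
      ((Fintype.equivFin (cl i j)).symm l).1.2,
    fun i j l => ⟨_, _, fun _ => Iff.rfl⟩, fun w => ?_⟩
  · refine (Fintype.card_subtype_le _).trans ?_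
    simpa using hA
  · constructor
    · rintro ⟨i, h⟩
      refine ⟨eI i, fun j => ?_⟩
      obtain ⟨p, hp⟩ := h (eJ.symm j)
      exact ⟨Fintype.equivFin _ ⟨(p, w p), by simpa using hp⟩, by simp⟩
    · rintro ⟨i, h⟩
      refine ⟨eI.symm i, fun j => ?_⟩
      obtain ⟨l, hl⟩ := h (eJ j)
      have hP := ((Fintype.equivFin (cl i (eJ j))).symm l).2
      rw [← hl] at hP
      exact ⟨_, by simpa only [eJ.symm_apply_apply] using hP⟩

/-- The prefix of length `i` of the infinite word `f`. -/
def wordPrefix (f : ℕ → A₃) (i : ℕ) : List A₃ := (List.range i).map f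

theorem wordPrefix_succ (f : ℕ → A₃) (i : ℕ) :
    wordPrefix f (i + 1) = wordPrefix f i ++ [f i] := by
  simp [wordPrefix, List.range_succ]

theorem append_singleton_mem_mul_singleton {A : Type*} (L : Language A) (l : List A) (x y : A) :
    l ++ [y] ∈ L * ({[x]} : Language A) ↔ l ∈ L ∧ y = x := by
  rw [Language.mem_mul]
  constructor
  · rintro ⟨u, hu, v, hv, h⟩
    obtain rfl : v = [x] := hv
    obtain ⟨rfl, h⟩ := List.append_inj' h rfl
    simp_all
  · rintro ⟨hl, rfl⟩
    exact ⟨l, hl, [y], rfl, rfl⟩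

theorem nil_notMem_mul_singleton {A : Type*} (L : Language A) (x : A) :
    [] ∉ L * ({[x]} : Language A) := by
  rw [Language.mem_mul]
  rintro ⟨u, hu, v, hv, h⟩
  obtain rfl : v = [x] := hv
  simp at h

/-- The words that lead from a balanced position to an open `a`: the language `K·a·c*`. -/
def openLang : Language A₃ := Klang * {[la]} * KStar.kstar {[lc]}

/-- The language `K·b·c*`. -/
def excessLang : Language A₃ := Klang * {[lb]} * KStar.kstar {[lc]}

theorem kstar_eq {A : Type*} (L : Language A) : KStar.kstar L = 1 + KStar.kstar L * L :=
  (Language.one_add_kstar_mul_self_eq_kstar L).symm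

theorem Klang_eq : Klang = 1 + (openLang * {[lb]} + Klang * {[lc]}) := by
  have h : Klang = KStar.kstar (({[la]} : Language A₃) * KStar.kstar {[lc]} * {[lb]} + {[lc]}) :=
    by simp [Klang, Kexp]
  rw [openLang]
  conv_lhs => rw [h, kstar_eq, ← h, mul_add]
  simp only [mul_assoc]

theorem mul_kstar_eq {A : Type*} (L M : Language A) :
    L * KStar.kstar M = L + L * KStar.kstar M * M := by
  conv_lhs => rw [kstar_eq, mul_add, mul_one, ← mul_assoc]

theorem K'lang_eq : K'lang = excessLang * {[lb]} +
    (K'lang * {[la]} + K'lang * {[lb]} + K'lang * {[lc]}) := by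
  have h : K'lang = (excessLang * {[lb]}) *
      KStar.kstar (({[la]} : Language A₃) + {[lb]} + {[lc]}) := by
    simp [K'lang, K'exp, excessLang, Klang, mul_assoc]
  conv_lhs => rw [h, mul_kstar_eq, ← h]
  simp only [mul_add]

theorem wordPrefix_succ_mem_Klang (f : ℕ → A₃) (i : ℕ) :
    wordPrefix f (i + 1) ∈ Klang ↔
      (wordPrefix f i ∈ openLang ∧ f i = lb) ∨ (wordPrefix f i ∈ Klang ∧ f i = lc) := by
  conv_lhs => rw [Klang_eq, wordPrefix_succ]
  simp only [Language.mem_add, append_singleton_mem_mul_singleton, Language.mem_one]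
  simp

theorem wordPrefix_succ_mem_mul_kstar (f : ℕ → A₃) (i : ℕ) (x : A₃) (L : Language A₃) :
    wordPrefix f (i + 1) ∈ L * {[x]} * KStar.kstar {[lc]} ↔
      (wordPrefix f i ∈ L ∧ f i = x) ∨
        (wordPrefix f i ∈ L * {[x]} * KStar.kstar {[lc]} ∧ f i = lc) := by
  conv_lhs => rw [mul_kstar_eq, wordPrefix_succ]
  simp only [Language.mem_add, append_singleton_mem_mul_singleton]

theorem nil_notMem_mul_kstar (x : A₃) (L : Language A₃) :
    [] ∉ L * {[x]} * KStar.kstar {[lc]} := by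
  rw [mul_kstar_eq]
  simp only [Language.mem_add, nil_notMem_mul_singleton, or_self, not_false_eq_true]

theorem nil_mem_Klang : [] ∈ Klang := by
  rw [Klang_eq, Language.mem_add]
  exact Or.inl rfl

theorem eq_letter (x : A₃) : x = la ∨ x = lb ∨ x = lc := by
  revert x; decide

theorem wordPrefix_succ_mem_K'lang (f : ℕ → A₃) (i : ℕ) :
    wordPrefix f (i + 1) ∈ K'lang ↔
      (wordPrefix f i ∈ excessLang ∧ f i = lb) ∨ wordPrefix f i ∈ K'lang := by
  conv_lhs => rw [K'lang_eq, wordPrefix_succ]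
  simp only [Language.mem_add, append_singleton_mem_mul_singleton]
  have := eq_letter (f i)
  tauto

theorem nil_notMem_K'lang : [] ∉ K'lang := by
  rw [K'lang_eq]
  simp only [Language.mem_add, nil_notMem_mul_singleton, or_self, not_false_eq_true]

/-- The last letter other than `c` strictly before position `p` is `x`. -/
def LastLetter (f : ℕ → A₃) (x : A₃) (p : ℕ) : Prop :=
  ∃ q < p, f q = x ∧ ∀ r, q < r → r < p → f r = lc

theorem lastLetter_succ (f : ℕ → A₃) (x : A₃) (p : ℕ) :
    LastLetter f x (p + 1) ↔ f p = x ∨ (LastLetter f x p ∧ f p = lc) := by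
  constructor
  · rintro ⟨q, hq, hx, h⟩
    obtain rfl | hq := Nat.lt_succ_iff_lt_or_eq.1 hq |>.symm
    · exact Or.inl hx
    · exact Or.inr ⟨⟨q, hq, hx, fun r h₁ h₂ => h r h₁ (by omega)⟩, h p hq (by omega)⟩
  · rintro (hx | ⟨⟨q, hq, hx, h⟩, hc⟩)
    · exact ⟨p, by omega, hx, fun r h₁ h₂ => by omega⟩
    · refine ⟨q, by omega, hx, fun r h₁ h₂ => ?_⟩
      obtain rfl | h₃ := Nat.lt_succ_iff_lt_or_eq.1 h₂ |>.symm
      · exact hc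
      · exact h r h₁ h₃

theorem not_lastLetter (f : ℕ → A₃) (x : A₃) (p : ℕ) :
    ¬ LastLetter f x p ↔ ∀ q < p, f q ≠ x ∨ ∃ r, q < r ∧ r < p ∧ f r ≠ lc := by
  simp only [LastLetter]
  push Not
  refine forall₂_congr fun q _ => ?_
  rw [imp_iff_not_or]

theorem lastLetter_la_iff (f : ℕ → A₃) (p : ℕ) :
    LastLetter f la p ↔ (∃ r < p, f r ≠ lc) ∧ ¬ LastLetter f lb p := by
  induction p with
  | zero => simp [LastLetter]
  | succ p ih =>
    rw [lastLetter_succ, lastLetter_succ, Nat.exists_lt_succ_right, ih]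
    rcases eq_letter (f p) with h | h | h <;> simp [h, la, lb, lc]

/-- Every `a` before position `i` occurs at a balanced position, and every `b` closes an `a`. -/
def Alternating (f : ℕ → A₃) (i : ℕ) : Prop :=
  ∀ p < i, (f p = la → ¬ LastLetter f la p) ∧ (f p = lb → LastLetter f la p)

theorem wordPrefix_mem_Klang_and_openLang (f : ℕ → A₃) (i : ℕ) :
    (wordPrefix f i ∈ Klang ↔ Alternating f i ∧ ¬ LastLetter f la i) ∧
      (wordPrefix f i ∈ openLang ↔ Alternating f i ∧ LastLetter f la i) := by
  induction i with
  | zero =>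
    have h₁ := nil_mem_Klang
    have h₂ := nil_notMem_mul_kstar la Klang
    rw [← openLang] at h₂
    simp [wordPrefix, Alternating, LastLetter, h₁, h₂]
  | succ i ih =>
    have hA : Alternating f (i + 1) ↔ Alternating f i ∧
        (f i = la → ¬ LastLetter f la i) ∧ (f i = lb → LastLetter f la i) :=
      Nat.forall_lt_succ_right
    rw [wordPrefix_succ_mem_Klang, lastLetter_succ, hA, openLang, wordPrefix_succ_mem_mul_kstar,
      ← openLang, ih.1, ih.2]
    rcases eq_letter (f i) with h | h | h <;> simp [h, la, lb, lc]

theorem wordPrefix_mem_excessLang (f : ℕ → A₃) (m : ℕ) :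
    wordPrefix f m ∈ excessLang ↔
      ∃ i < m, wordPrefix f i ∈ Klang ∧ f i = lb ∧ ∀ r, i < r → r < m → f r = lc := by
  induction m with
  | zero => simpa [wordPrefix, excessLang] using nil_notMem_mul_kstar lb Klang
  | succ m ih =>
    rw [excessLang, wordPrefix_succ_mem_mul_kstar, ← excessLang, ih, Nat.exists_lt_succ_right,
      or_comm]
    refine or_congr ?_ ?_
    · constructor
      · rintro ⟨⟨i, hi, hK, hb, h⟩, hc⟩
        refine ⟨i, hi, hK, hb, fun r h₁ h₂ => ?_⟩
        obtain rfl | h₃ := Nat.lt_succ_iff_lt_or_eq.1 h₂ |>.symm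
        · exact hc
        · exact h r h₁ h₃
      · rintro ⟨i, hi, hK, hb, h⟩
        exact ⟨⟨i, hi, hK, hb, fun r h₁ h₂ => h r h₁ (by omega)⟩, h m hi (by omega)⟩
    · simp only [and_congr_right_iff]
      exact fun _ => ⟨fun h => ⟨h, fun r h₁ h₂ => by omega⟩, fun h => h.1⟩

theorem wordPrefix_mem_K'lang (f : ℕ → A₃) (n : ℕ) :
    wordPrefix f n ∈ K'lang ↔ ∃ k < n, wordPrefix f k ∈ excessLang ∧ f k = lb := by
  induction n with
  | zero => simpa [wordPrefix] using nil_notMem_K'lang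
  | succ n ih => rw [wordPrefix_succ_mem_K'lang, ih, Nat.exists_lt_succ_right, or_comm]

theorem wordPrefix_mem_Klang_iff (f : ℕ → A₃) (i : ℕ) :
    wordPrefix f i ∈ Klang ↔
      (∀ p < i, ∀ q < p, f p ≠ la ∨ f q ≠ la ∨ ∃ r, q < r ∧ r < p ∧ f r ≠ lc) ∧
      (∀ p < i, ∀ q < p, f p ≠ lb ∨ f q ≠ lb ∨ ∃ r, q < r ∧ r < p ∧ f r ≠ lc) ∧
      (∀ p < i, f p ≠ lb ∨ ∃ r < p, f r ≠ lc) ∧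
      (∀ p < i, f p ≠ la ∨ ∃ r, p < r ∧ r < i ∧ f r ≠ lc) := by
  have h (x : A₃) (p : ℕ) : (∀ q < p, f p ≠ x ∨ f q ≠ x ∨ ∃ r, q < r ∧ r < p ∧ f r ≠ lc) ↔
      (f p = x → ¬ LastLetter f x p) := by
    rw [not_lastLetter]
    constructor
    · exact fun H hx q hq => (H q hq).resolve_left (not_not.2 hx)
    · exact fun H q hq => or_iff_not_imp_left.2 fun hx => H (not_not.1 hx) q hq
  simp only [h, (wordPrefix_mem_Klang_and_openLang f i).1, ← not_lastLetter, Alternating]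
  rw [← and_assoc, ← and_assoc]
  refine and_congr_left fun _ => ?_
  constructor
  · intro H
    refine ⟨⟨fun p hp => (H p hp).1, fun p hp hb => ?_⟩, fun p hp => ?_⟩
    · exact ((lastLetter_la_iff f p).1 ((H p hp).2 hb)).2
    · by_cases hb : f p = lb
      · exact Or.inr ((lastLetter_la_iff f p).1 ((H p hp).2 hb)).1
      · exact Or.inl hb
  · rintro ⟨⟨H₁, H₂⟩, H₃⟩ p hp
    exact ⟨H₁ p hp, fun hb => (lastLetter_la_iff f p).2
      ⟨(H₃ p hp).resolve_left (not_not.2 hb), H₂ p hp hb⟩⟩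

/-- The literals of the clause of kind `t` with parameters `p`, `q` in the circuit for `K'`; the
top OR-gate guesses the positions `i < k` of the factor `b·c*·b`. A clause whose side condition
fails contains every literal. -/
def clause {n : ℕ} (i k : Fin n) (t : Fin 7) (p q r : Fin n) (x : A₃) : Prop :=
  match t with
  | 0 => r = i ∧ x = lb ∧ i < k
  | 1 => r = k ∧ x = lb
  | 2 => i < p → p < k → r = p ∧ x = lc
  | 3 => p < i → q < p → (r = p ∧ x ≠ la) ∨ (r = q ∧ x ≠ la) ∨ (q < r ∧ r < p ∧ x ≠ lc)
  | 4 => p < i → q < p → (r = p ∧ x ≠ lb) ∨ (r = q ∧ x ≠ lb) ∨ (q < r ∧ r < p ∧ x ≠ lc)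
  | 5 => p < i → (r = p ∧ x ≠ lb) ∨ (r < p ∧ x ≠ lc)
  | 6 => p < i → (r = p ∧ x ≠ la) ∨ (p < r ∧ r < i ∧ x ≠ lc)

theorem mem_K'lang_iff_clause {n : ℕ} (w : Fin n → A₃) :
    List.ofFn w ∈ K'lang ↔ ∃ ik : Fin n × Fin n, ∀ j : Fin 7 × Fin n × Fin n,
      ∃ r, clause ik.1 ik.2 j.1 j.2.1 j.2.2 r (w r) := by
  obtain ⟨f, hf⟩ : ∃ f : ℕ → A₃, ∀ p : Fin n, w p = f p :=
    ⟨fun p => if h : p < n then w ⟨p, h⟩ else lc, fun p => by simp⟩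
  have hw : List.ofFn w = wordPrefix f n := by
    apply List.ext_getElem <;> simp [wordPrefix, hf]
  simp only [hw, wordPrefix_mem_K'lang, wordPrefix_mem_excessLang, wordPrefix_mem_Klang_iff, hf]
  constructor
  · rintro ⟨k, hk, ⟨i, hi, ⟨h₃, h₄, h₅, h₆⟩, hib, h₂⟩, hkb⟩
    refine ⟨(⟨i, hi.trans hk⟩, ⟨k, hk⟩), fun ⟨t, p, q⟩ => ?_⟩
    have hin := hi.trans hk
    match t with
    | 0 => exact ⟨⟨i, hin⟩, rfl, hib, hi⟩
    | 1 => exact ⟨⟨k, hk⟩, rfl, hkb⟩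
    | 2 => exact ⟨p, fun hp hpk => ⟨rfl, h₂ p hp hpk⟩⟩
    | 3 =>
      by_cases hp : p.1 < i ∧ q < p
      · rcases h₃ p hp.1 q hp.2 with h | h | ⟨r, h, h', hr⟩
        · exact ⟨p, fun _ _ => Or.inl ⟨rfl, h⟩⟩
        · exact ⟨q, fun _ _ => Or.inr (Or.inl ⟨rfl, h⟩)⟩
        · exact ⟨⟨r, h'.trans p.2⟩, fun _ _ => Or.inr (Or.inr ⟨h, h', hr⟩)⟩
      · exact ⟨p, fun h h' => absurd ⟨h, h'⟩ hp⟩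
    | 4 =>
      by_cases hp : p.1 < i ∧ q < p
      · rcases h₄ p hp.1 q hp.2 with h | h | ⟨r, h, h', hr⟩
        · exact ⟨p, fun _ _ => Or.inl ⟨rfl, h⟩⟩
        · exact ⟨q, fun _ _ => Or.inr (Or.inl ⟨rfl, h⟩)⟩
        · exact ⟨⟨r, h'.trans p.2⟩, fun _ _ => Or.inr (Or.inr ⟨h, h', hr⟩)⟩
      · exact ⟨p, fun h h' => absurd ⟨h, h'⟩ hp⟩
    | 5 =>
      by_cases hp : p.1 < i
      · rcases h₅ p hp with h | ⟨r, h, hr⟩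
        · exact ⟨p, fun _ => Or.inl ⟨rfl, h⟩⟩
        · exact ⟨⟨r, h.trans p.2⟩, fun _ => Or.inr ⟨h, hr⟩⟩
      · exact ⟨p, fun h => absurd h hp⟩
    | 6 =>
      by_cases hp : p.1 < i
      · rcases h₆ p hp with h | ⟨r, h, h', hr⟩
        · exact ⟨p, fun _ => Or.inl ⟨rfl, h⟩⟩
        · exact ⟨⟨r, h'.trans hin⟩, fun _ => Or.inr ⟨h, h', hr⟩⟩
      · exact ⟨p, fun h => absurd h hp⟩
  · rintro ⟨⟨i, k⟩, H⟩
    have hC (t : Fin 7) (p q : Fin n) : ∃ r, clause i k t p q r (f r) := H (t, p, q)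
    obtain ⟨r, hr, hib, hik⟩ := hC 0 i i
    subst hr
    obtain ⟨s, hs, hkb⟩ := hC 1 r r
    subst hs
    refine ⟨s, s.2, ⟨r, hik, ⟨fun p hp q hq => ?_, fun p hp q hq => ?_, fun p hp => ?_,
      fun p hp => ?_⟩, hib, fun p hp hps => ?_⟩, hkb⟩
    · obtain ⟨u, hu⟩ := hC 3 ⟨p, hp.trans r.2⟩ ⟨q, (hq.trans hp).trans r.2⟩
      rcases hu hp hq with ⟨rfl, h⟩ | ⟨rfl, h⟩ | h
      · exact Or.inl h
      · exact Or.inr (Or.inl h)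
      · exact Or.inr (Or.inr ⟨u, h⟩)
    · obtain ⟨u, hu⟩ := hC 4 ⟨p, hp.trans r.2⟩ ⟨q, (hq.trans hp).trans r.2⟩
      rcases hu hp hq with ⟨rfl, h⟩ | ⟨rfl, h⟩ | h
      · exact Or.inl h
      · exact Or.inr (Or.inl h)
      · exact Or.inr (Or.inr ⟨u, h⟩)
    · obtain ⟨u, hu⟩ := hC 5 ⟨p, hp.trans r.2⟩ r
      rcases hu hp with ⟨rfl, h⟩ | h
      · exact Or.inl h
      · exact Or.inr ⟨u, h⟩
    · obtain ⟨u, hu⟩ := hC 6 ⟨p, hp.trans r.2⟩ r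
      rcases hu hp with ⟨rfl, h⟩ | h
      · exact Or.inl h
      · exact Or.inr ⟨u, h⟩
    · obtain ⟨u, hu⟩ := hC 2 ⟨p, hps.trans s.2⟩ r
      obtain ⟨rfl, h⟩ := hu hp hps
      exact h

/-- `K'` is recognized by a polynomial-size depth-3 OR-output circuit family. -/
theorem K'_recDepth3 : RecDepth3 K'lang := by
  refine ⟨7, 2, fun n => ⟨_, Depth3Circuit.of_fintype (fun (ik : Fin n × Fin n)
    (j : Fin 7 × Fin n × Fin n) => clause ik.1 ik.2 j.1 j.2.1 j.2.2) ?_ ?_ ?_,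
    fun w => (mem_K'lang_iff_clause w).symm⟩⟩
  all_goals simp; nlinarith
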